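/- Let T be a tree with at least two vertices, all of whose edges are positive, and let G_T be the signed graph obtained from T by attaching to each leaf of T an unbalanced circuit: the circuits are pairwise vertex-disjoint and each meets T only in the leaf it is attached to. Let v_1, …, v_p be the vertices of T of degree at least 3, with degrees d_1, …, d_p. Then for every finite additive abelian group Γ of odd order k and every orientation of G_T, the number of nowhere-zero Γ-flows in G_T equals (k−1) · Π_{i=1}^{p} ( Σ_{j=0}^{d_i−2} (−1)^j · C(d_i−1, j) · k^{d_i−2−j} ), where C(a,b) denotes the binomial coefficient. -/

import Mathlib

/-- A signed graph: each edge `e` has endpoints `a e`, `b e` (equal for a loop)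
and a sign `sign e ∈ {1, -1}`. -/
structure SignedGraph (V E : Type) where
  a : E → V
  b : E → V
  sign : E → ℤ
  sign_unit : ∀ e, sign e = 1 ∨ sign e = -1

namespace SignedGraph

variable {V E : Type}

/-- An orientation of a signed graph: incidence signs `ηa e`, `ηb e ∈ {1,-1}` at the
two ends of each edge, with `ηa e * ηb e = - sign e`. -/
structure Orientation (G : SignedGraph V E) where
  ηa : E → ℤ
  ηb : E → ℤ
  ηa_unit : ∀ e, ηa e = 1 ∨ ηa e = -1
  ηb_unit : ∀ e, ηb e = 1 ∨ ηb e = -1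
  compat : ∀ e, ηa e * ηb e = - G.sign e

/-- Kirchhoff's law at every vertex: a `Γ`-flow. -/
def IsFlow [Fintype E] [DecidableEq V] {Γ : Type} [AddCommGroup Γ]
    (G : SignedGraph V E) (O : G.Orientation) (f : E → Γ) : Prop :=
  ∀ v : V, ∑ e : E,
    ((if G.a e = v then O.ηa e else 0) + (if G.b e = v then O.ηb e else 0)) • f e = 0

/-- Degree of a vertex in the subgraph with edge set `S` (a loop counts twice). -/
def deg [DecidableEq V] (G : SignedGraph V E) (S : Finset E) (v : V) : ℕ :=
  ∑ e ∈ S, ((if G.a e = v then 1 else 0) + (if G.b e = v then 1 else 0))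

/-- Adjacency via an edge in the edge set `S`. -/
def AdjIn (G : SignedGraph V E) (S : Finset E) (v w : V) : Prop :=
  ∃ e ∈ S, (G.a e = v ∧ G.b e = w) ∨ (G.a e = w ∧ G.b e = v)

/-- A circuit: a nonempty edge set forming a connected 2-regular subgraph. -/
def IsCircuit [DecidableEq V] (G : SignedGraph V E) (C : Finset E) : Prop :=
  C.Nonempty ∧
  (∀ v : V, (∃ e ∈ C, G.a e = v ∨ G.b e = v) → G.deg C v = 2) ∧
  (∀ v w : V, (∃ e ∈ C, G.a e = v ∨ G.b e = v) → (∃ e ∈ C, G.a e = w ∨ G.b e = w) →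
     Relation.ReflTransGen (G.AdjIn C) v w)

/-- An unbalanced circuit: a circuit with an odd number of negative edges. -/
def IsUnbalancedCircuit [DecidableEq V] (G : SignedGraph V E) (C : Finset E) : Prop :=
  G.IsCircuit C ∧ Odd (C.filter (fun e => G.sign e = -1)).card

/-- The subgraph with edge set `S` is balanced (contains no unbalanced circuit). -/
def BalancedOn [DecidableEq V] (G : SignedGraph V E) (S : Finset E) : Prop :=
  ∀ C : Finset E, C ⊆ S → ¬ G.IsUnbalancedCircuit C

/-- A balanced signed graph: contains no unbalanced circuit. -/
def Balanced [DecidableEq V] (G : SignedGraph V E) : Prop :=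
  ∀ C : Finset E, ¬ G.IsUnbalancedCircuit C

/-- An unbalanced signed graph: contains an unbalanced circuit. -/
def Unbalanced [DecidableEq V] (G : SignedGraph V E) : Prop :=
  ∃ C : Finset E, G.IsUnbalancedCircuit C

/-- Adjacency in the whole signed graph. -/
def Adj (G : SignedGraph V E) (v w : V) : Prop :=
  ∃ e : E, (G.a e = v ∧ G.b e = w) ∨ (G.a e = w ∧ G.b e = v)

/-- A connected signed graph: every two vertices are joined by a walk. -/
def Connected (G : SignedGraph V E) : Prop :=
  ∀ v w : V, Relation.ReflTransGen G.Adj v w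

/-- The setoid on vertices whose classes are the connected components. -/
def compSetoid (G : SignedGraph V E) : Setoid V :=
  ⟨Relation.EqvGen G.Adj, Relation.EqvGen.is_equivalence _⟩

/-- The connected component of a vertex. -/
def component (G : SignedGraph V E) (v : V) : Quotient G.compSetoid :=
  Quotient.mk G.compSetoid v

/-- The number of vertices of a connected component. -/
noncomputable def compN (G : SignedGraph V E) (q : Quotient G.compSetoid) : ℕ :=
  Nat.card {v : V // G.component v = q}

/-- The number of edges of a connected component. -/
noncomputable def compM (G : SignedGraph V E) (q : Quotient G.compSetoid) : ℕ :=
  Nat.card {e : E // G.component (G.a e) = q}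

/-- The connected component `q` is unbalanced (contains an unbalanced circuit). -/
def CompUnbalanced [DecidableEq V] (G : SignedGraph V E) (q : Quotient G.compSetoid) : Prop :=
  ∃ C : Finset E, G.IsUnbalancedCircuit C ∧ ∃ e ∈ C, G.component (G.a e) = q

open Classical in
/-- `β` of a connected component: `m - n` if unbalanced, `m - n + 1` if balanced. -/
noncomputable def compBeta [DecidableEq V] (G : SignedGraph V E)
    (q : Quotient G.compSetoid) : ℕ :=
  if G.CompUnbalanced q then G.compM q - G.compN q else G.compM q + 1 - G.compN q

/-- `β(G)`: the sum of `β(ω)` over the connected components `ω` of `G`. -/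
noncomputable def beta [DecidableEq V] (G : SignedGraph V E) : ℕ :=
  ∑ᶠ q : Quotient G.compSetoid, G.compBeta q

/-- `κ(G)`: the number of unbalanced connected components of `G`. -/
noncomputable def kappa [DecidableEq V] (G : SignedGraph V E) : ℕ :=
  Nat.card {q : Quotient G.compSetoid // G.CompUnbalanced q}

/-- The signed graph `G - F` obtained by deleting the edges in `F` (all vertices kept). -/
def delete [DecidableEq E] (G : SignedGraph V E) (F : Finset E) :
    SignedGraph V {e : E // e ∉ F} :=
  ⟨fun e => G.a e.1, fun e => G.b e.1, fun e => G.sign e.1, fun e => G.sign_unit e.1⟩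

/-- The edges with both endpoints in `X` (the edge set of `G[X]`). -/
def insideEdges [Fintype E] [DecidableEq V] (G : SignedGraph V E) (X : Finset V) : Finset E :=
  Finset.univ.filter (fun e => G.a e ∈ X ∧ G.b e ∈ X)

/-- The edges with one endpoint in `X` and one outside: `[X, Xᶜ]`. -/
def crossEdges [Fintype E] [DecidableEq V] (G : SignedGraph V E) (X : Finset V) : Finset E :=
  Finset.univ.filter (fun e => (G.a e ∈ X ∧ G.b e ∉ X) ∨ (G.a e ∉ X ∧ G.b e ∈ X))

/-- A cut: a nonempty set `B = [X, Xᶜ] ∪ E_X` where `X` is a nonempty vertex set and `E_X`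
is a set of edges of `G[X]` minimal with `G[X] - E_X` balanced. -/
def IsCut [Fintype E] [DecidableEq V] [DecidableEq E]
    (G : SignedGraph V E) (B : Finset E) : Prop :=
  B.Nonempty ∧ ∃ X : Finset V, X.Nonempty ∧ ∃ EX : Finset E,
    EX ⊆ G.insideEdges X ∧
    G.BalancedOn (G.insideEdges X \ EX) ∧
    (∀ EX' ⊆ EX, G.BalancedOn (G.insideEdges X \ EX') → EX' = EX) ∧
    B = G.crossEdges X ∪ EX

/-- A bond: a cut that is minimal (under inclusion) among cuts. -/
def IsBond [Fintype E] [DecidableEq V] [DecidableEq E]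
    (G : SignedGraph V E) (B : Finset E) : Prop :=
  G.IsCut B ∧ ∀ B' ⊆ B, G.IsCut B' → B' = B

/-- A broken bond: a bond minus its largest edge (w.r.t. the linear order on `E`). -/
def IsBrokenBond [Fintype E] [DecidableEq V] [LinearOrder E]
    (G : SignedGraph V E) (D : Finset E) : Prop :=
  ∃ B : Finset E, G.IsBond B ∧ ∃ h : B.Nonempty, D = B.erase (B.max' h)

/-- `F` contains no broken bond of `G` as a subset. -/
def NoBrokenBond [Fintype E] [DecidableEq V] [LinearOrder E]
    (G : SignedGraph V E) (F : Finset E) : Prop :=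
  ∀ D : Finset E, G.IsBrokenBond D → ¬ D ⊆ F

end SignedGraph

/-- `ε(Γ)`: the largest `d` such that `Γ` has a subgroup isomorphic to `(ℤ/2ℤ)^d`. -/
noncomputable def epsilon (Γ : Type) [AddCommGroup Γ] [Fintype Γ] : ℕ :=
  sSup {d : ℕ | ∃ H : AddSubgroup Γ, Nonempty (H ≃+ (Fin d → ZMod 2))}

namespace SignedGraph

open Finset

section Signs

variable {V E : Type} {G : SignedGraph V E}

/-- The incidence sign of a half-edge. -/
def Orientation.tipSign (O : G.Orientation) (h : E × Bool) : ℤ :=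
  if h.2 then O.ηa h.1 else O.ηb h.1

theorem Orientation.tipSign_unit (O : G.Orientation) (h : E × Bool) :
    O.tipSign h = 1 ∨ O.tipSign h = -1 := by
  unfold tipSign
  split_ifs
  · exact O.ηa_unit _
  · exact O.ηb_unit _

theorem prod_sign_of_odd {C : Finset E} (hC : Odd (C.filter (fun e => G.sign e = -1)).card) :
    ∏ e ∈ C, G.sign e = -1 := by
  have : ∏ e ∈ C, G.sign e = ∏ e ∈ C, if G.sign e = -1 then (-1 : ℤ) else 1 := by
    refine prod_congr rfl fun e _ => ?_
    rcases G.sign_unit e with h | h <;> simp [h]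
  rw [this, ← prod_filter, prod_const, hC.neg_one_pow]

end Signs

section HalfEdges

variable {V E : Type} [DecidableEq V] (G : SignedGraph V E)

/-- The vertices touched by the edges of `S`. -/
def touched [Fintype V] (S : Finset E) : Finset V :=
  univ.filter (fun v => ∃ e ∈ S, G.a e = v ∨ G.b e = v)

/-- The vertex at which a half-edge is attached. -/
def tip (h : E × Bool) : V := if h.2 then G.a h.1 else G.b h.1

/-- The half-edges of `S` at the vertex `v`. -/
def halfEdges (S : Finset E) (v : V) : Finset (E × Bool) :=
  (S ×ˢ univ).filter (fun h => G.tip h = v)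

variable {G}

theorem mem_touched [Fintype V] {S : Finset E} {v : V} :
    v ∈ G.touched S ↔ ∃ e ∈ S, G.a e = v ∨ G.b e = v := by
  simp [touched]

theorem mem_halfEdges {S : Finset E} {v : V} {h : E × Bool} :
    h ∈ G.halfEdges S v ↔ h.1 ∈ S ∧ G.tip h = v := by
  simp [halfEdges]

theorem exists_halfEdge_iff {S : Finset E} {v : V} {e : E} :
    (∃ i, (e, i) ∈ G.halfEdges S v) ↔ e ∈ S ∧ (G.a e = v ∨ G.b e = v) := by
  simp only [mem_halfEdges, tip, Bool.exists_bool]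
  simp only [Bool.false_eq_true, if_false, if_true]
  tauto

theorem a_mem_touched [Fintype V] {S : Finset E} {e : E} (he : e ∈ S) : G.a e ∈ G.touched S :=
  mem_touched.2 ⟨e, he, Or.inl rfl⟩

theorem b_mem_touched [Fintype V] {S : Finset E} {e : E} (he : e ∈ S) : G.b e ∈ G.touched S :=
  mem_touched.2 ⟨e, he, Or.inr rfl⟩

theorem touched_mono [Fintype V] {S S' : Finset E} (h : S ⊆ S') : G.touched S ⊆ G.touched S' := by
  intro v hv
  obtain ⟨e, he, hev⟩ := mem_touched.1 hv
  exact mem_touched.2 ⟨e, h he, hev⟩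

@[to_additive]
theorem prod_halfEdges {M : Type*} [CommMonoid M] (S : Finset E) (v : V) (F : E × Bool → M) :
    ∏ h ∈ G.halfEdges S v, F h = ∏ e ∈ S,
      (if G.a e = v then F (e, true) else 1) * (if G.b e = v then F (e, false) else 1) := by
  rw [halfEdges, prod_filter, prod_product]
  refine prod_congr rfl fun e _ => ?_
  simp [tip]

@[to_additive]
theorem prod_touched_prod_halfEdges [Fintype V] {M : Type*} [CommMonoid M] (S : Finset E)
    (F : E × Bool → M) :
    ∏ v ∈ G.touched S, ∏ h ∈ G.halfEdges S v, F h = ∏ e ∈ S, F (e, true) * F (e, false) := by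
  unfold halfEdges
  rw [prod_fiberwise_of_maps_to, prod_product]
  · simp
  · rintro ⟨e, i⟩ h
    have he : e ∈ S := (mem_product.1 h).1
    cases i
    · exact b_mem_touched he
    · exact a_mem_touched he

theorem card_halfEdges (S : Finset E) (v : V) : (G.halfEdges S v).card = G.deg S v := by
  rw [card_eq_sum_ones, sum_halfEdges, deg]

theorem sum_deg_touched [Fintype V] (S : Finset E) :
    ∑ v ∈ G.touched S, G.deg S v = 2 * S.card := by
  simp_rw [← card_halfEdges, card_eq_sum_ones]
  rw [sum_touched_sum_halfEdges]
  simp [mul_comm]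

theorem deg_pos_iff {S : Finset E} {v : V} :
    0 < G.deg S v ↔ ∃ e ∈ S, G.a e = v ∨ G.b e = v := by
  rw [← card_halfEdges, card_pos]
  constructor
  · rintro ⟨⟨e, i⟩, h⟩
    exact ⟨e, exists_halfEdge_iff.1 ⟨i, h⟩⟩
  · rintro ⟨e, h⟩
    obtain ⟨i, hi⟩ := exists_halfEdge_iff.2 h
    exact ⟨_, hi⟩

end HalfEdges

section Boundary

variable {V E : Type} [DecidableEq V] {G : SignedGraph V E}

/-- The incidence coefficient of the edge `e` at the vertex `v`. -/
def Orientation.coeff (O : G.Orientation) (v : V) (e : E) : ℤ :=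
  (if G.a e = v then O.ηa e else 0) + (if G.b e = v then O.ηb e else 0)

theorem Orientation.coeff_eq_zero (O : G.Orientation) {v : V} {e : E}
    (h : ¬ (G.a e = v ∨ G.b e = v)) : O.coeff v e = 0 := by
  rw [not_or] at h
  simp [coeff, h.1, h.2]

theorem Orientation.coeff_unit (O : G.Orientation) {v : V} {e : E}
    (h : G.a e = v ∨ G.b e = v) (hne : G.a e ≠ G.b e) :
    O.coeff v e = 1 ∨ O.coeff v e = -1 := by
  rcases h with h | h
  · have : G.b e ≠ v := fun h' => hne (h.trans h'.symm)
    simpa [coeff, h, this] using O.ηa_unit e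
  · have : G.a e ≠ v := fun h' => hne (h'.trans h.symm)
    simpa [coeff, h, this] using O.ηb_unit e

/-- The boundary of a `Γ`-valued chain. -/
def boundary [Fintype E] (O : G.Orientation) {Γ : Type} [AddCommGroup Γ] :
    (E → Γ) →+ (V → Γ) where
  toFun f v := ∑ e, O.coeff v e • f e
  map_zero' := by ext; simp
  map_add' f g := by ext; simp [sum_add_distrib]

variable [Fintype E] (O : G.Orientation) {Γ : Type} [AddCommGroup Γ]

theorem boundary_apply (f : E → Γ) (v : V) :
    boundary O f v = ∑ e, O.coeff v e • f e := rfl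

theorem isFlow_iff (f : E → Γ) : G.IsFlow O f ↔ boundary O f = 0 :=
  funext_iff.symm

theorem boundary_eq_sum {S : Finset E} {f : E → Γ} (hf : ∀ e ∉ S, f e = 0) (v : V) :
    boundary O f v = ∑ e ∈ S, O.coeff v e • f e := by
  rw [boundary_apply]
  refine (sum_subset (subset_univ S) fun e _ he => ?_).symm
  rw [hf e he, smul_zero]

theorem boundary_eq_sum_halfEdges {S : Finset E} {f : E → Γ} (hf : ∀ e ∉ S, f e = 0) (v : V) :
    boundary O f v = ∑ h ∈ G.halfEdges S v, O.tipSign h • f h.1 := by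
  rw [boundary_eq_sum O hf, sum_halfEdges]
  refine sum_congr rfl fun e _ => ?_
  simp [Orientation.coeff, Orientation.tipSign, add_smul, ite_smul]

theorem boundary_eq_zero_of_not_touched {S : Finset E} {f : E → Γ} (hf : ∀ e ∉ S, f e = 0)
    {v : V} (hv : ¬ ∃ e ∈ S, G.a e = v ∨ G.b e = v) : boundary O f v = 0 := by
  rw [boundary_eq_sum O hf]
  refine sum_eq_zero fun e he => ?_
  rw [O.coeff_eq_zero fun h => hv ⟨e, he, h⟩, zero_smul]

end Boundary

section Circuits

variable {V E : Type} [DecidableEq V] {G : SignedGraph V E} {C : Finset E}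

theorem IsCircuit.card_halfEdges (hC : G.IsCircuit C) {v : V} {h : E × Bool}
    (hh : h ∈ G.halfEdges C v) : (G.halfEdges C v).card = 2 := by
  rw [SignedGraph.card_halfEdges]
  exact hC.2.1 v ⟨h.1, exists_halfEdge_iff.1 ⟨h.2, hh⟩⟩

theorem IsCircuit.halfEdges_eq_pair [DecidableEq E] (hC : G.IsCircuit C) {v : V}
    {h h' : E × Bool} (hh : h ∈ G.halfEdges C v) (hh' : h' ∈ G.halfEdges C v) (hne : h ≠ h') :
    G.halfEdges C v = {h, h'} := by
  refine (eq_of_subset_of_card_le ?_ ?_).symm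
  · intro x hx
    rcases mem_insert.1 hx with rfl | hx
    · exact hh
    · rwa [mem_singleton.1 hx]
  · rw [hC.card_halfEdges hh, card_pair hne]

theorem IsCircuit.card_touched [Fintype V] (hC : G.IsCircuit C) :
    (G.touched C).card = C.card := by
  have h := G.sum_deg_touched C
  rw [sum_congr rfl fun v hv => hC.2.1 v (mem_touched.1 hv), sum_const, smul_eq_mul] at h
  omega

/-- A property of edges that propagates across vertices holds on a whole circuit. -/
theorem IsCircuit.forall_of_propagates (hC : G.IsCircuit C) {Q : E → Prop} {e₀ : E}
    (he₀ : e₀ ∈ C) (h₀ : Q e₀)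
    (hstep : ∀ v, ∀ h ∈ G.halfEdges C v, ∀ h' ∈ G.halfEdges C v, Q h.1 → Q h'.1) :
    ∀ e ∈ C, Q e := by
  have hstep' : ∀ v, ∀ e ∈ C, (G.a e = v ∨ G.b e = v) → Q e →
      ∀ e' ∈ C, (G.a e' = v ∨ G.b e' = v) → Q e' := by
    intro v e he hv hQ e' he' hv'
    obtain ⟨i, hi⟩ := exists_halfEdge_iff.2 ⟨he, hv⟩
    obtain ⟨j, hj⟩ := exists_halfEdge_iff.2 ⟨he', hv'⟩
    exact hstep v _ hi _ hj hQ
  intro e he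
  have hreach := hC.2.2 (G.a e₀) (G.a e) ⟨e₀, he₀, Or.inl rfl⟩ ⟨e, he, Or.inl rfl⟩
  suffices ∀ w, Relation.ReflTransGen (G.AdjIn C) (G.a e₀) w →
      ∀ e' ∈ C, (G.a e' = w ∨ G.b e' = w) → Q e' from this _ hreach e he (Or.inl rfl)
  intro w hw
  induction hw with
  | refl => exact hstep' _ e₀ he₀ (Or.inl rfl) h₀
  | @tail u w _ huw ih =>
    obtain ⟨e₁, he₁, h⟩ := huw
    exact hstep' w e₁ he₁ (by tauto) (ih e₁ he₁ (by tauto))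

end Circuits

section UnbalancedCircuits

variable {V E : Type} [DecidableEq V] {G : SignedGraph V E} {C : Finset E}
  [Fintype E] (O : G.Orientation) {Γ : Type} [AddCommGroup Γ]

theorem IsCircuit.eq_or_eq_neg (hC : G.IsCircuit C) {f : E → Γ} (hf : ∀ e ∉ C, f e = 0) {v : V}
    (hv : boundary O f v = 0) {h h' : E × Bool} (hh : h ∈ G.halfEdges C v)
    (hh' : h' ∈ G.halfEdges C v) : f h'.1 = f h.1 ∨ f h'.1 = - f h.1 := by
  classical
  by_cases hne : h = h'
  · exact Or.inl (by rw [hne])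
  rw [boundary_eq_sum_halfEdges O hf, hC.halfEdges_eq_pair hh hh' hne, sum_pair hne] at hv
  rcases O.tipSign_unit h with h1 | h1 <;> rcases O.tipSign_unit h' with h2 | h2 <;>
    rw [h1, h2] at hv <;> simp only [one_smul, neg_smul] at hv
  · exact Or.inr (eq_neg_of_add_eq_zero_right hv)
  · exact Or.inl (add_neg_eq_zero.1 hv).symm
  · exact Or.inl (neg_add_eq_zero.1 hv).symm
  · right
    rw [← neg_add, neg_eq_zero] at hv
    exact eq_neg_of_add_eq_zero_right hv

theorem eq_zero_of_add_self_eq_zero [Fintype Γ] (hodd : Odd (Fintype.card Γ)) {y : Γ}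
    (hy : y + y = 0) : y = 0 := by
  have h2 : addOrderOf y ∣ 2 := addOrderOf_dvd_of_nsmul_eq_zero (by rw [two_nsmul, hy])
  have h1 : addOrderOf y ∣ Fintype.card Γ := addOrderOf_dvd_card
  have := Nat.dvd_gcd h2 h1
  rw [Nat.Coprime.gcd_eq_one (Nat.coprime_two_left.2 hodd)] at this
  exact AddMonoid.addOrderOf_eq_one_iff.1 (Nat.dvd_one.1 this)

theorem IsUnbalancedCircuit.boundary_injective [Fintype V] [Fintype Γ]
    (hodd : Odd (Fintype.card Γ)) (hC : G.IsUnbalancedCircuit C) {f : E → Γ}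
    (hf : ∀ e ∉ C, f e = 0) (hb : boundary O f = 0) : f = 0 := by
  classical
  by_contra hne
  obtain ⟨e₀, hy⟩ : ∃ e, f e ≠ 0 := by
    by_contra! h
    exact hne (funext h)
  have he₀ : e₀ ∈ C := by
    by_contra h
    exact hy (hf _ h)
  set y := f e₀ with hydef
  have hval : ∀ e ∈ C, f e = y ∨ f e = -y := by
    refine hC.1.forall_of_propagates he₀ (Or.inl rfl) fun v h hh h' hh' hQ => ?_
    rcases hC.1.eq_or_eq_neg O hf (congrFun hb v) hh hh' with h1 | h1 <;>
      rcases hQ with h2 | h2 <;> simp [h1, h2]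
  let s : E → ℤ := fun e => if f e = y then 1 else -1
  have hs_unit : ∀ e, s e = 1 ∨ s e = -1 := by
    intro e
    by_cases h : f e = y <;> simp [s, h]
  have hs : ∀ e ∈ C, f e = s e • y := by
    intro e he
    by_cases h : f e = y
    · simp [s, h]
    · simpa [s, h] using (hval e he).resolve_left h
  have hvert : ∀ v ∈ G.touched C, ∏ h ∈ G.halfEdges C v, (O.tipSign h * s h.1) = -1 := by
    intro v hv
    obtain ⟨h, h', hne, heq⟩ := card_eq_two.1
      ((SignedGraph.card_halfEdges C v).trans (hC.1.2.1 v (mem_touched.1 hv)))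
    have hmem : h.1 ∈ C := (mem_halfEdges.1 (heq ▸ mem_insert_self h {h'})).1
    have hmem' : h'.1 ∈ C :=
      (mem_halfEdges.1 (heq ▸ mem_insert_of_mem (mem_singleton_self h'))).1
    have hb' := congrFun hb v
    rw [boundary_eq_sum_halfEdges O hf, heq, sum_pair hne, hs _ hmem, hs _ hmem',
      smul_smul, smul_smul] at hb'
    rw [heq, prod_pair hne]
    have hy2 : y + y ≠ 0 := fun h => hy (eq_zero_of_add_self_eq_zero hodd h)
    have hy2' : -y + -y ≠ 0 := fun h => hy2 (by rwa [← neg_add, neg_eq_zero] at h)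
    rcases O.tipSign_unit h with h1 | h1 <;> rcases O.tipSign_unit h' with h2 | h2 <;>
      rcases hs_unit h.1 with h3 | h3 <;> rcases hs_unit h'.1 with h4 | h4 <;>
      simp [h1, h2, h3, h4, hy2, hy2'] at hb' ⊢
  have htotal := prod_touched_prod_halfEdges (G := G) C (fun h => O.tipSign h * s h.1)
  rw [prod_congr rfl hvert, prod_const, hC.1.card_touched] at htotal
  have hedge : ∀ e ∈ C, (O.tipSign (e, true) * s e) * (O.tipSign (e, false) * s e) =
      (-1) * G.sign e := by
    intro e _
    have h1 : s e * s e = 1 := by rcases hs_unit e with h | h <;> simp [h]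
    have h2 := O.compat e
    simp only [Orientation.tipSign, if_true, Bool.false_eq_true, if_false]
    linear_combination (s e * s e) * h2 - G.sign e * h1
  rw [prod_congr rfl hedge, prod_mul_distrib, prod_const, prod_sign_of_odd hC.2] at htotal
  rcases neg_one_pow_eq_or ℤ C.card with h | h <;> rw [h] at htotal <;> norm_num at htotal

theorem IsUnbalancedCircuit.exists_boundary_eq [Fintype V] [Fintype Γ]
    (hodd : Odd (Fintype.card Γ)) (hC : G.IsUnbalancedCircuit C) {l : V}
    (hl : l ∈ G.touched C) (x : Γ) :
    ∃ f : E → Γ, (∀ e ∉ C, f e = 0) ∧ boundary O f = Pi.single l x := by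
  classical
  let ext : (C → Γ) → E → Γ := fun g e => if h : e ∈ C then g ⟨e, h⟩ else 0
  have hext : ∀ g, ∀ e ∉ C, ext g e = 0 := fun g e he => by simp [ext, he]
  let φ : (C → Γ) → (G.touched C → Γ) := fun g v => boundary O (ext g) v
  have hinj : Function.Injective φ := by
    intro g g' hgg
    have hzero : ext g - ext g' = 0 := by
      refine hC.boundary_injective O hodd (fun e he => ?_) (funext fun v => ?_)
      · simp [hext _ e he]
      · rw [map_sub, Pi.sub_apply, Pi.zero_apply]
        by_cases hv : v ∈ G.touched C
        · exact sub_eq_zero.2 (congrFun hgg ⟨v, hv⟩)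
        · rw [mem_touched] at hv
          rw [boundary_eq_zero_of_not_touched O (hext g) hv,
            boundary_eq_zero_of_not_touched O (hext g') hv, sub_zero]
    ext e
    simpa [ext, sub_eq_zero] using congrFun hzero e
  have hbij : Function.Bijective φ :=
    (Fintype.bijective_iff_injective_and_card φ).2 ⟨hinj, by simp [hC.1.card_touched]⟩
  obtain ⟨g, hg⟩ := hbij.2 (fun v => (Pi.single l x : V → Γ) v)
  refine ⟨ext g, hext g, funext fun v => ?_⟩
  by_cases hv : v ∈ G.touched C
  · exact congrFun hg ⟨v, hv⟩
  · rw [Pi.single_eq_of_ne (by rintro rfl; exact hv hl)]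
    rw [mem_touched] at hv
    exact boundary_eq_zero_of_not_touched O (hext g) hv

theorem IsCircuit.ne_zero_of_boundary_eq_single [Fintype V] (hC : G.IsCircuit C) {l : V} {x : Γ}
    (hx : x ≠ 0) {f : E → Γ} (hf : ∀ e ∉ C, f e = 0) (hb : boundary O f = Pi.single l x) :
    ∀ e ∈ C, f e ≠ 0 := by
  classical
  by_contra! ⟨e₀, he₀, h₀⟩
  let s : E → ℤ := fun e => if f e = 0 then 1 else -1
  have hs : ∀ e, s e * s e = 1 := by
    intro e
    by_cases h : f e = 0 <;> simp [s, h]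
  have hiff : ∀ v, v ≠ l → ∀ h ∈ G.halfEdges C v, ∀ h' ∈ G.halfEdges C v, s h'.1 = s h.1 := by
    intro v hv h hh h' hh'
    have hbv : boundary O f v = 0 := by rw [hb, Pi.single_eq_of_ne hv]
    rcases hC.eq_or_eq_neg O hf hbv hh hh' with h1 | h1 <;> simp [s, h1]
  have hprod : ∀ v ∈ G.touched C, v ≠ l → ∏ h ∈ G.halfEdges C v, s h.1 = 1 := by
    intro v hv hvl
    obtain ⟨h, h', hne, heq⟩ := card_eq_two.1
      ((SignedGraph.card_halfEdges C v).trans (hC.2.1 v (mem_touched.1 hv)))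
    rw [heq, prod_pair hne, hiff v hvl h (by simp [heq]) h' (by simp [heq]), hs]
  have hall : f = 0 := by
    funext e
    by_cases he : e ∈ C
    swap
    · exact hf e he
    refine hC.forall_of_propagates (Q := fun e => f e = 0) he₀ h₀ (fun v h hh h' hh' hQ => ?_) e he
    by_cases hv : v = l
    swap
    · have := hiff v hv h hh h' hh'
      by_contra h0
      simp [s, hQ, h0] at this
    by_cases hne : h = h'
    · rwa [← hne]
    have htotal := prod_touched_prod_halfEdges (G := G) C (fun h => s h.1)
    have hvt : v ∈ G.touched C := mem_touched.2 ⟨h.1, exists_halfEdge_iff.1 ⟨h.2, hh⟩⟩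
    rw [prod_congr rfl fun e _ => hs e, prod_const_one,
      prod_eq_single_of_mem v hvt fun u hu huv => hprod u hu (hv ▸ huv),
      hC.halfEdges_eq_pair hh hh' hne, prod_pair hne] at htotal
    by_contra h0
    simp [s, hQ, h0] at htotal
  rw [hall, map_zero] at hb
  exact hx (by simpa using (congrFun hb l).symm)

end UnbalancedCircuits


section Forests

theorem boundary_single_zmod_two {V E : Type} [DecidableEq V] [Fintype E] [DecidableEq E]
    {G : SignedGraph V E} (O : G.Orientation) (e : E) :
    boundary O (Pi.single e (1 : ZMod 2)) = Pi.single (G.a e) 1 + Pi.single (G.b e) 1 := by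
  funext v
  rw [boundary_apply, sum_eq_single_of_mem e (mem_univ e)
    (fun e' _ h => by rw [Pi.single_eq_of_ne h, smul_zero])]
  have hη : ∀ {z : ℤ}, z = 1 ∨ z = -1 → (z : ZMod 2) = 1 := by
    rintro z (rfl | rfl) <;> decide
  simp only [Pi.single_eq_same, Pi.add_apply, Pi.single_apply, zsmul_eq_mul, mul_one,
    Orientation.coeff, Int.cast_add, apply_ite (Int.cast : ℤ → ZMod 2), hη (O.ηa_unit e),
    hη (O.ηb_unit e), Int.cast_zero, eq_comm (a := v)]

variable {V E : Type} [Fintype V] [DecidableEq V] [Fintype E] {G : SignedGraph V E}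
  (O : G.Orientation)

theorem sum_boundary_zmod_two (f : E → ZMod 2) : ∑ v, boundary O f v = 0 := by
  simp only [boundary_apply]
  rw [sum_comm]
  refine sum_eq_zero fun e _ => ?_
  rw [← sum_smul]
  simp only [Orientation.coeff, sum_add_distrib, sum_ite_eq, mem_univ, if_true]
  rcases O.ηa_unit e with h1 | h1 <;> rcases O.ηb_unit e with h2 | h2 <;> rw [h1, h2] <;>
    generalize f e = x <;> revert x <;> decide

/-- If an edge set touches at most as many vertices as it has edges, then it carries a
nonzero cycle modulo two. -/
theorem exists_cycle_of_card_touched_le {S : Finset E} (hS : S.Nonempty)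
    (hcard : (G.touched S).card ≤ S.card) :
    ∃ f : E → ZMod 2, (∀ e ∉ S, f e = 0) ∧ f ≠ 0 ∧ boundary O f = 0 := by
  classical
  obtain ⟨e₀, he₀⟩ := hS
  set v₀ := G.a e₀
  have hv₀ : v₀ ∈ G.touched S := a_mem_touched he₀
  let ext : (S → ZMod 2) → E → ZMod 2 := fun g e => if h : e ∈ S then g ⟨e, h⟩ else 0
  have hext : ∀ g, ∀ e ∉ S, ext g e = 0 := fun g e he => by simp [ext, he]
  let φ : (S → ZMod 2) → ((G.touched S).erase v₀ → ZMod 2) := fun g v => boundary O (ext g) v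
  have hlt : Fintype.card ((G.touched S).erase v₀ → ZMod 2) < Fintype.card (S → ZMod 2) := by
    simp only [Fintype.card_fun, ZMod.card, Fintype.card_coe]
    refine Nat.pow_lt_pow_right one_lt_two ?_
    rw [card_erase_of_mem hv₀]
    have := card_pos.2 ⟨v₀, hv₀⟩
    omega
  obtain ⟨g, g', hne, hgg⟩ := Fintype.exists_ne_map_eq_of_card_lt φ hlt
  have hoff : ∀ v ≠ v₀, boundary O (ext g - ext g') v = 0 := by
    intro v hv
    rw [map_sub, Pi.sub_apply]
    by_cases hvS : v ∈ G.touched S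
    · exact sub_eq_zero.2 (congrFun hgg ⟨v, mem_erase.2 ⟨hv, hvS⟩⟩)
    · rw [mem_touched] at hvS
      rw [boundary_eq_zero_of_not_touched O (hext g) hvS,
        boundary_eq_zero_of_not_touched O (hext g') hvS, sub_zero]
  refine ⟨ext g - ext g', fun e he => by simp [hext _ e he], fun h0 => hne ?_, funext fun v => ?_⟩
  · ext e
    simpa [ext, sub_eq_zero] using congrArg (fun z => (z : ZMod 2)) (congrFun h0 e)
  · by_cases hv : v = v₀
    · rw [hv, ← sum_eq_single_of_mem (f := boundary O (ext g - ext g')) v₀ (mem_univ _)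
        (fun u _ hu => hoff u hu), sum_boundary_zmod_two, Pi.zero_apply]
    · exact hoff v hv

/-- The support of a cycle modulo two of minimal support is a circuit. -/
theorem isCircuit_of_minimal_cycle [DecidableEq E] {f : E → ZMod 2} (hne : f ≠ 0)
    (hb : boundary O f = 0)
    (hmin : ∀ g : E → ZMod 2, g ≠ 0 → boundary O g = 0 → (∀ e, f e = 0 → g e = 0) →
      ∀ e, g e = 0 → f e = 0) :
    G.IsCircuit (univ.filter (fun e => f e ≠ 0)) := by
  set S := univ.filter (fun e => f e ≠ 0) with hSdef
  have hmem : ∀ {e}, e ∈ S ↔ f e ≠ 0 := by simp [S]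
  have hfS : ∀ e ∉ S, f e = 0 := fun e he => by simpa [hmem] using he
  have hnonempty : S.Nonempty := by
    by_contra h
    exact hne (funext fun e => hfS e (by simp [not_nonempty_iff_eq_empty.1 h]))
  have hdeg2 : ∀ v ∈ G.touched S, 2 ≤ G.deg S v := by
    intro v hv
    have hpos := deg_pos_iff.2 (mem_touched.1 hv)
    by_contra hlt
    obtain ⟨h, hh⟩ := card_eq_one.1
      ((SignedGraph.card_halfEdges S v).trans (by omega : G.deg S v = 1))
    have hbv := congrFun hb v
    have hhS : h.1 ∈ S := (mem_halfEdges.1 (hh ▸ mem_singleton_self h)).1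
    rw [boundary_eq_sum_halfEdges O hfS, hh, sum_singleton] at hbv
    rcases O.tipSign_unit h with h1 | h1 <;> rw [h1] at hbv <;>
      simp at hbv <;> exact hmem.1 hhS hbv
  have hcard : S.card ≤ (G.touched S).card := by
    by_contra! hlt
    obtain ⟨e₀, he₀⟩ := hnonempty
    have hle := card_le_card (touched_mono (G := G) (erase_subset e₀ S))
    have hpos := card_pos.2 ⟨_, a_mem_touched (G := G) he₀⟩
    have herase := card_erase_of_mem he₀
    obtain ⟨g, hg, hg0, hgb⟩ := exists_cycle_of_card_touched_le O (S := S.erase e₀)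
      (card_pos.1 (by omega)) (by omega)
    exact hmem.1 he₀ (hmin g hg0 hgb
      (fun e he => hg e fun h => hmem.1 (mem_of_mem_erase h) he) e₀ (hg e₀ (by simp)))
  refine ⟨hnonempty, fun v hv => ?_, fun v w hv hw => ?_⟩
  · have hsum := G.sum_deg_touched S
    have hle : ∑ v ∈ G.touched S, G.deg S v ≤ ∑ v ∈ G.touched S, 2 := by
      rw [hsum, sum_const, smul_eq_mul]
      omega
    exact ((sum_eq_sum_iff_of_le hdeg2).1 (le_antisymm (sum_le_sum hdeg2) hle) v
      (mem_touched.2 hv)).symm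
  · classical
    let R : V → Prop := Relation.ReflTransGen (G.AdjIn S) v
    have hR : ∀ e ∈ S, (R (G.a e) ↔ R (G.b e)) := fun e he =>
      ⟨fun h => h.tail ⟨e, he, Or.inl ⟨rfl, rfl⟩⟩, fun h => h.tail ⟨e, he, Or.inr ⟨rfl, rfl⟩⟩⟩
    let g : E → ZMod 2 := fun e => if R (G.a e) then f e else 0
    have hgR : ∀ u e, (G.a e = u ∨ G.b e = u) → g e = if R u then f e else 0 := by
      intro u e he
      by_cases heS : e ∈ S
      · rcases he with rfl | rfl
        · rfl
        · simp only [g, hR e heS]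
      · simp [g, hfS e heS]
    have hgb : boundary O g = 0 := by
      funext u
      have hterm : ∀ e, O.coeff u e • g e = if R u then O.coeff u e • f e else 0 := by
        intro e
        by_cases he : G.a e = u ∨ G.b e = u
        · rw [hgR u e he, smul_ite, smul_zero]
        · simp [O.coeff_eq_zero he]
      rw [boundary_apply, sum_congr rfl fun e _ => hterm e]
      by_cases hu : R u
      · simp only [if_pos hu]
        exact congrFun hb u
      · simp [hu]
    obtain ⟨e₁, he₁, hv⟩ := hv
    obtain ⟨e₂, he₂, hw⟩ := hw
    have hg0 : g ≠ 0 := fun h => by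
      have := congrFun h e₁
      rw [hgR v e₁ hv, if_pos Relation.ReflTransGen.refl] at this
      exact hmem.1 he₁ this
    by_contra hRw
    exact hmem.1 he₂ (hmin g hg0 hgb (fun e he => by simp [g, he]) e₂
      (by rw [hgR w e₂ hw, if_neg hRw]))

/-- An edge set without circuits carries no nonzero cycle modulo two. -/
theorem eq_zero_of_acyclic {T : Finset E} (hacyc : ∀ C : Finset E, C ⊆ T → ¬ G.IsCircuit C)
    {f : E → ZMod 2} (hf : ∀ e ∉ T, f e = 0) (hb : boundary O f = 0) : f = 0 := by
  classical
  by_contra hne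
  let P : Finset E → Prop := fun S =>
    ∃ g : E → ZMod 2, g ≠ 0 ∧ boundary O g = 0 ∧ (∀ e ∉ T, g e = 0) ∧
      S = univ.filter (fun e => g e ≠ 0)
  obtain ⟨S, ⟨g, hg0, hgb, hgT, rfl⟩, hmin⟩ :=
    WellFounded.has_min (wellFounded_lt (α := Finset E)) {S | P S} ⟨_, f, hne, hb, hf, rfl⟩
  refine hacyc _ (fun e he => ?_) (isCircuit_of_minimal_cycle O hg0 hgb ?_)
  · by_contra h
    exact (mem_filter.1 he).2 (hgT e h)
  · intro g' hg'0 hg'b hsub e he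
    by_contra hge
    refine hmin _ ⟨g', hg'0, hg'b, fun e he => hsub e (hgT e he), rfl⟩ ?_
    refine (ssubset_iff_of_subset ?_).2 ⟨e, by simp [hge], by simp [he]⟩
    intro x hx
    simp only [mem_filter, mem_univ, true_and] at hx ⊢
    exact fun h => hx (hsub x h)

/-- A nonempty acyclic edge set has a vertex of degree one. -/
theorem exists_deg_eq_one {T : Finset E} (hne : T.Nonempty)
    (hacyc : ∀ C : Finset E, C ⊆ T → ¬ G.IsCircuit C) (O : G.Orientation) :
    ∃ v, G.deg T v = 1 := by
  by_contra! h
  have h2 : ∀ v ∈ G.touched T, 2 ≤ G.deg T v := fun v hv => by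
    have := deg_pos_iff.2 (mem_touched.1 hv)
    have := h v
    omega
  have hsum := sum_le_sum h2
  rw [sum_deg_touched, sum_const, smul_eq_mul] at hsum
  obtain ⟨f, hf, hf0, hb⟩ := exists_cycle_of_card_touched_le O hne (by omega)
  exact hf0 (eq_zero_of_acyclic O hacyc hf hb)

end Forests


section Counting

/-- The alternating sum counting the nowhere-zero solutions of a signed sum of `n` elements of an
abelian group of order `k` being equal to a fixed nonzero element. -/
def nonzeroSumCount (k : ℤ) (n : ℕ) : ℤ :=
  ∑ j ∈ range n, (-1 : ℤ) ^ j * (n.choose j : ℤ) * k ^ (n - 1 - j)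

theorem mul_nonzeroSumCount (k : ℤ) (n : ℕ) :
    k * nonzeroSumCount k n = (k - 1) ^ n - (-1) ^ n := by
  rw [show k - 1 = -1 + k by ring, add_pow, sum_range_succ, nonzeroSumCount, mul_sum]
  simp only [Nat.sub_self, pow_zero, Nat.choose_self, Nat.cast_one, mul_one, add_sub_cancel_right]
  refine sum_congr rfl fun j hj => ?_
  have hj' := mem_range.1 hj
  rw [show n - j = n - 1 - j + 1 by omega, pow_succ]
  ring

theorem unit_smul_unit_smul {Γ : Type} [AddCommGroup Γ] {z : ℤ} (hz : z = 1 ∨ z = -1) (x : Γ) : z • z • x = x := by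
  rcases hz with rfl | rfl <;> simp

variable {E : Type} [Fintype E] [DecidableEq E] {Γ : Type} [AddCommGroup Γ] [Fintype Γ]

open Classical in
/-- The functions whose support is exactly `S`. -/
noncomputable def fullSupport (Γ : Type) [AddCommGroup Γ] [Fintype Γ] (S : Finset E) :
    Finset (E → Γ) :=
  univ.filter (fun f => ∀ e, f e ≠ 0 ↔ e ∈ S)

theorem mem_fullSupport {S : Finset E} {f : E → Γ} :
    f ∈ fullSupport Γ S ↔ ∀ e, f e ≠ 0 ↔ e ∈ S := by
  simp [fullSupport]

theorem apply_eq_zero_of_mem_fullSupport {S : Finset E} {f : E → Γ} (hf : f ∈ fullSupport Γ S) :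
    ∀ e ∉ S, f e = 0 := fun e he => not_not.1 fun h => he ((mem_fullSupport.1 hf e).1 h)

theorem card_fullSupport (S : Finset E) :
    ((fullSupport Γ S).card : ℤ) = ((Fintype.card Γ : ℤ) - 1) ^ S.card := by
  classical
  have h : fullSupport Γ S =
      Fintype.piFinset (fun e => if e ∈ S then (univ : Finset Γ).erase 0 else {0}) := by
    ext f
    rw [mem_fullSupport, Fintype.mem_piFinset]
    refine forall_congr' fun e => ?_
    by_cases he : e ∈ S <;> simp [he]
  rw [h, Fintype.card_piFinset]
  simp only [apply_ite card, card_singleton]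
  rw [prod_ite_mem, univ_inter, prod_const, card_erase_of_mem (mem_univ _), card_univ, Nat.cast_pow,
    Nat.cast_sub Fintype.card_pos, Nat.cast_one]

open Classical in
/-- The number of functions with support `K` and a prescribed nonzero signed sum. -/
theorem card_fullSupport_sum_eq (w : E → ℤ) (K : Finset E) (hw : ∀ e ∈ K, w e = 1 ∨ w e = -1)
    {s : Γ} (hs : s ≠ 0) :
    (((fullSupport Γ K).filter (fun f => ∑ e ∈ K, w e • f e = s)).card : ℤ) =
      nonzeroSumCount (Fintype.card Γ) K.card := by
  have hk : (Fintype.card Γ : ℤ) ≠ 0 := by exact_mod_cast Fintype.card_ne_zero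
  refine mul_left_cancel₀ hk ?_
  rw [mul_nonzeroSumCount]
  induction K using Finset.induction_on with
  | empty => simp [hs.symm]
  | insert e K he ih =>
    have hwe := hw e (mem_insert_self e K)
    have hsumK : ∀ (f : E → Γ) x, ∑ i ∈ K, w i • Function.update f e x i = ∑ i ∈ K, w i • f i := by
      intro f x
      refine sum_congr rfl fun i hi => ?_
      rw [Function.update_of_ne (by rintro rfl; exact he hi)]
    have hbij : ((fullSupport Γ (insert e K)).filter
          (fun f => ∑ i ∈ insert e K, w i • f i = s)).card =
        ((fullSupport Γ K).filter (fun f => ¬ ∑ i ∈ K, w i • f i = s)).card := by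
      refine card_nbij' (fun f => Function.update f e 0)
        (fun g => Function.update g e (w e • (s - ∑ i ∈ K, w i • g i))) ?_ ?_ ?_ ?_
      · intro f hf
        simp only [coe_filter, Set.mem_ofPred_eq, mem_fullSupport, sum_insert he] at hf ⊢
        rw [hsumK]
        refine ⟨fun i => ?_, fun h => ?_⟩
        · by_cases hi : i = e
          · subst hi; simp [he]
          · simpa [Function.update_of_ne hi, hi] using hf.1 i
        · rw [h, add_eq_right] at hf
          refine (hf.1 e).2 (mem_insert_self e K) ?_
          rw [← unit_smul_unit_smul hwe (f e), hf.2, smul_zero]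
      · intro g hg
        simp only [coe_filter, Set.mem_ofPred_eq, mem_fullSupport, sum_insert he] at hg ⊢
        rw [hsumK, Function.update_self, unit_smul_unit_smul hwe]
        refine ⟨fun i => ?_, sub_add_cancel _ _⟩
        by_cases hi : i = e
        · subst hi
          rw [Function.update_self]
          simp only [mem_insert_self, iff_true]
          intro h
          have h' := congrArg (fun x => w i • x) h
          simp only [unit_smul_unit_smul hwe, smul_zero] at h'
          exact hg.2 (sub_eq_zero.1 h').symm
        · simpa [Function.update_of_ne hi, hi] using hg.1 i
      · intro f hf
        simp only [coe_filter, Set.mem_ofPred_eq, sum_insert he] at hf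
        funext i
        by_cases hi : i = e
        · subst hi
          simp only [Function.update_self, hsumK]
          rw [← hf.2, add_sub_cancel_right, unit_smul_unit_smul hwe]
        · simp [Function.update_of_ne hi]
      · intro g hg
        simp only [coe_filter, Set.mem_ofPred_eq] at hg
        funext i
        by_cases hi : i = e
        · subst hi
          simpa using (apply_eq_zero_of_mem_fullSupport hg.1 i he).symm
        · simp [Function.update_of_ne hi]
    have hsplit := card_filter_add_card_filter_not (s := fullSupport Γ K)
      (fun f => ∑ i ∈ K, w i • f i = s)
    have hsplit' := congrArg (Nat.cast (R := ℤ)) hsplit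
    rw [Nat.cast_add, card_fullSupport] at hsplit'
    have ihw := ih fun i hi => hw i (mem_insert_of_mem hi)
    rw [hbij, card_insert_of_notMem he]
    linear_combination (Fintype.card Γ : ℤ) * hsplit' - ihw

/-- Extending a function with support `S` to a larger support `S ∪ K` subject to one further
Kirchhoff condition, involving exactly one edge of `S`. -/
theorem card_fullSupport_union {S K : Finset E} (hSK : Disjoint S K) {p : E} (hp : p ∈ S)
    (w : E → ℤ) (hwK : ∀ e ∈ K, w e = 1 ∨ w e = -1) (hwp : w p = 1 ∨ w p = -1)
    (hwS : ∀ e ∈ S, e ≠ p → w e = 0) (P Q : (E → Γ) → Prop) [DecidablePred P] [DecidablePred Q]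
    (hP : ∀ f ∈ fullSupport Γ (S ∪ K), P f ↔ P (S.piecewise f 0))
    (hQ : ∀ f ∈ fullSupport Γ (S ∪ K), Q f ↔ P f ∧ ∑ e ∈ S ∪ K, w e • f e = 0) :
    (((fullSupport Γ (S ∪ K)).filter Q).card : ℤ) =
      ((fullSupport Γ S).filter P).card * nonzeroSumCount (Fintype.card Γ) K.card := by
  classical
  rw [filter_congr hQ]
  have hKS : ∀ {e}, e ∈ K → e ∉ S := fun h h' => disjoint_left.1 hSK h' h
  have hres : ∀ f ∈ fullSupport Γ (S ∪ K), S.piecewise f 0 ∈ fullSupport Γ S := by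
    intro f hf
    rw [mem_fullSupport] at hf ⊢
    intro e
    by_cases he : e ∈ S
    · simpa [he] using hf e
    · simp [he]
  have hsumS : ∀ f : E → Γ, ∑ e ∈ S, w e • f e = w p • f p := fun f =>
    sum_eq_single_of_mem p hp fun e he hne => by rw [hwS e he hne, zero_smul]
  rw [card_eq_sum_card_fiberwise (f := fun f => S.piecewise f 0)
    (t := (fullSupport Γ S).filter P)]
  swap
  · intro f hf
    obtain ⟨hf1, hf2, -⟩ := mem_filter.1 hf
    exact mem_coe.2 (mem_filter.2 ⟨hres f hf1, (hP f hf1).1 hf2⟩)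
  rw [Nat.cast_sum, ← nsmul_eq_mul, ← sum_const]
  refine sum_congr rfl fun g hg => ?_
  obtain ⟨hgS, hgP⟩ := mem_filter.1 hg
  have hg0 := apply_eq_zero_of_mem_fullSupport hgS
  have hne : -(w p • g p) ≠ 0 := by
    rw [neg_ne_zero]
    intro h
    refine (mem_fullSupport.1 hgS p).2 hp ?_
    rw [← unit_smul_unit_smul hwp (g p), h, smul_zero]
  rw [← card_fullSupport_sum_eq w K hwK hne, Nat.cast_inj]
  refine card_nbij' (fun f => K.piecewise f 0) (fun h => h + g) ?_ ?_ ?_ ?_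
  · intro f hf
    simp only [coe_filter, Set.mem_ofPred_eq, mem_filter] at hf ⊢
    obtain ⟨⟨hf1, hf2, hf3⟩, rfl⟩ := hf
    rw [sum_union hSK, hsumS] at hf3
    refine ⟨mem_fullSupport.2 fun e => ?_, ?_⟩
    · by_cases he : e ∈ K
      · simpa [he] using mem_fullSupport.1 hf1 e
      · simp [he]
    · rw [piecewise_eq_of_mem _ _ _ hp, ← add_eq_zero_iff_eq_neg', ← hf3]
      congr 1
      exact sum_congr rfl fun e he => by rw [piecewise_eq_of_mem _ _ _ he]
  · intro h hh
    simp only [coe_filter, Set.mem_ofPred_eq, mem_filter] at hh ⊢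
    have hh0 := apply_eq_zero_of_mem_fullSupport hh.1
    have hr : S.piecewise (h + g) 0 = g := by
      funext e
      by_cases he : e ∈ S
      · simp [he, hh0 e fun h' => hKS h' he]
      · simp [he, hg0 e he]
    have hmem : h + g ∈ fullSupport Γ (S ∪ K) := mem_fullSupport.2 fun e => by
      by_cases he : e ∈ S
      · simpa [he, hh0 e fun h' => hKS h' he] using mem_fullSupport.1 hgS e
      · simpa [he, hg0 e he] using mem_fullSupport.1 hh.1 e
    refine ⟨⟨hmem, (hP _ hmem).2 (hr.symm ▸ hgP), ?_⟩, hr⟩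
    rw [sum_union hSK, hsumS, Pi.add_apply, hh0 p fun h' => hKS h' hp, zero_add,
      add_comm, ← eq_neg_iff_add_eq_zero, ← hh.2]
    exact sum_congr rfl fun e he => by rw [Pi.add_apply, hg0 e (hKS he), add_zero]
  · intro f hf
    simp only [coe_filter, Set.mem_ofPred_eq, mem_filter] at hf
    obtain ⟨⟨hf1, -, -⟩, rfl⟩ := hf
    have hf0 := apply_eq_zero_of_mem_fullSupport hf1
    funext e
    by_cases heS : e ∈ S
    · have heK : e ∉ K := fun h' => hKS h' heS
      simp [heS, heK]
    · by_cases heK : e ∈ K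
      · simp [heS, heK]
      · simp [heS, heK, hf0 e]
  · intro h hh
    simp only [coe_filter, Set.mem_ofPred_eq] at hh
    have hh0 := apply_eq_zero_of_mem_fullSupport hh.1
    funext e
    by_cases he : e ∈ K
    · simp [he, hg0 e (hKS he)]
    · simp [he, hh0 e he]

end Counting


section Growing

variable {V E : Type} [DecidableEq V] {G : SignedGraph V E}

/-- The edges of `T` at the vertex `v`. -/
def star (G : SignedGraph V E) (T : Finset E) (v : V) : Finset E :=
  T.filter (fun e => G.a e = v ∨ G.b e = v)

theorem mem_star {T : Finset E} {v : V} {e : E} :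
    e ∈ G.star T v ↔ e ∈ T ∧ (G.a e = v ∨ G.b e = v) := by
  simp [star]

theorem deg_eq_card_star {T : Finset E} (hT : ∀ e ∈ T, G.a e ≠ G.b e) (v : V) :
    G.deg T v = (G.star T v).card := by
  rw [star, card_filter, deg]
  refine sum_congr rfl fun e he => ?_
  have := hT e he
  by_cases ha : G.a e = v <;> by_cases hb : G.b e = v <;> simp [ha, hb]
  exact this (ha.trans hb.symm)

variable [Fintype V] [DecidableEq E]

/-- The pairs `(S, X)` obtained by growing a subtree `S` of `T` from its leaf `r`, where each
step adds all the edges of `T` at a leaf of `S` which is not a leaf of `T`; the set `X` records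
the vertices treated in this way. -/
inductive Grown (G : SignedGraph V E) (T : Finset E) (r : V) : Finset E → Finset V → Prop
  | base (e : E) (he : e ∈ G.star T r) : Grown G T r {e} ∅
  | step (S : Finset E) (X : Finset V) (v : V) (h : Grown G T r S X) (hv : v ∈ G.touched S)
      (hX : v ∉ X) (hdeg : 2 ≤ G.deg T v) : Grown G T r (S ∪ G.star T v) (insert v X)

theorem Grown.subset {T : Finset E} {r : V} {S : Finset E} {X : Finset V}
    (h : G.Grown T r S X) : S ⊆ T := by
  induction h with
  | base e he => exact singleton_subset_iff.2 (mem_star.1 he).1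
  | step S X v h hv hX hdeg ih => exact union_subset ih (filter_subset _ _)

theorem Grown.star_subset {T : Finset E} {r : V} {S : Finset E} {X : Finset V}
    (h : G.Grown T r S X) : ∀ v ∈ X, 2 ≤ G.deg T v ∧ G.star T v ⊆ S := by
  induction h with
  | base e he => simp
  | step S X v h hv hX hdeg ih =>
    intro u hu
    rcases mem_insert.1 hu with rfl | hu
    · exact ⟨hdeg, subset_union_right⟩
    · exact ⟨(ih u hu).1, (ih u hu).2.trans subset_union_left⟩

theorem add_self_zmod_two {V : Type} (x : V → ZMod 2) : x + x = 0 :=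
  funext fun v => CharTwo.add_self_eq_zero (x v)

variable [Fintype E]

theorem Grown.exists_path (O : G.Orientation) {T : Finset E} {r : V} {S : Finset E}
    {X : Finset V} (h : G.Grown T r S X) : ∀ v ∈ G.touched S, ∃ f : E → ZMod 2,
      (∀ e ∉ S, f e = 0) ∧ boundary O f = Pi.single r 1 + Pi.single v 1 := by
  have hedge : ∀ {e : E} {u v : V}, G.a e = u ∨ G.b e = u → G.a e = v ∨ G.b e = v → u ≠ v →
      boundary O (Pi.single e (1 : ZMod 2)) = Pi.single u 1 + Pi.single v 1 := by
    intro e u v hu hv huv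
    rw [boundary_single_zmod_two]
    rcases hu with rfl | rfl <;> rcases hv with rfl | rfl
    · exact absurd rfl huv
    · rfl
    · exact add_comm _ _
    · exact absurd rfl huv
  induction h with
  | base e he =>
    intro v hv
    obtain ⟨e', he', hev⟩ := mem_touched.1 hv
    rw [mem_singleton] at he'
    subst he'
    by_cases hrv : r = v
    · subst hrv
      refine ⟨0, by simp, ?_⟩
      rw [map_zero, add_self_zmod_two]
    · refine ⟨Pi.single e' 1, fun e he => Pi.single_eq_of_ne (by simpa using he) _, ?_⟩
      exact hedge (mem_star.1 he).2 hev hrv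
  | step S X v h hv hX hdeg ih =>
    intro u hu
    by_cases huS : u ∈ G.touched S
    · obtain ⟨f, hf, hb⟩ := ih u huS
      exact ⟨f, fun e he => hf e fun h => he (mem_union_left _ h), hb⟩
    · obtain ⟨e, he, heu⟩ := mem_touched.1 hu
      have heS : e ∉ S := fun h => huS (mem_touched.2 ⟨e, h, heu⟩)
      have hev := (mem_star.1 ((mem_union.1 he).resolve_left heS)).2
      have huv : v ≠ u := by
        rintro rfl
        exact huS hv
      obtain ⟨f, hf, hb⟩ := ih v hv
      refine ⟨f + Pi.single e 1, fun e' he' => ?_, ?_⟩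
      · rw [Pi.add_apply, hf e' fun h => he' (mem_union_left _ h), Pi.single_eq_of_ne, add_zero]
        rintro rfl
        exact he' he
      · rw [map_add, hb, hedge hev heu huv, add_assoc, ← add_assoc (Pi.single v 1 : V → ZMod 2),
          add_self_zmod_two, zero_add]

variable {T : Finset E}

theorem ends_ne_of_acyclic (hacyc : ∀ C : Finset E, C ⊆ T → ¬ G.IsCircuit C)
    (O : G.Orientation) : ∀ e ∈ T, G.a e ≠ G.b e := by
  intro e he hloop
  have h0 := eq_zero_of_acyclic O hacyc (f := Pi.single e 1)
    (fun e' he' => Pi.single_eq_of_ne (by rintro rfl; exact he' he) _)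
    (by rw [boundary_single_zmod_two, hloop, add_self_zmod_two])
  simpa using congrFun h0 e

/-- A grown subtree is an induced subgraph. -/
theorem Grown.mem_of_ends_touched (hacyc : ∀ C : Finset E, C ⊆ T → ¬ G.IsCircuit C)
    (O : G.Orientation) {r : V} {S : Finset E} {X : Finset V}
    (h : G.Grown T r S X) {e : E} (he : e ∈ T) (ha : G.a e ∈ G.touched S)
    (hb : G.b e ∈ G.touched S) : e ∈ S := by
  by_contra heS
  obtain ⟨f, hf, hfb⟩ := h.exists_path O _ ha
  obtain ⟨g, hg, hgb⟩ := h.exists_path O _ hb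
  have h0 := eq_zero_of_acyclic O hacyc (f := f + g + Pi.single e 1) ?_ ?_
  · simpa [hf e heS, hg e heS] using congrFun h0 e
  · intro e' he'
    have heS' : e' ∉ S := fun h' => he' (h.subset h')
    have hne : e' ≠ e := fun h' => he' (h' ▸ he)
    simp [hf e' heS', hg e' heS', hne]
  · rw [map_add, map_add, hfb, hgb, boundary_single_zmod_two]
    generalize (Pi.single r 1 : V → ZMod 2) = x
    generalize (Pi.single (G.a e) 1 : V → ZMod 2) = y
    generalize (Pi.single (G.b e) 1 : V → ZMod 2) = z
    rw [show x + y + (x + z) + (y + z) = (x + x) + (y + y) + (z + z) by abel]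
    simp [add_self_zmod_two]

theorem eq_of_same_ends (hacyc : ∀ C : Finset E, C ⊆ T → ¬ G.IsCircuit C)
    (O : G.Orientation) {e e' : E} (he : e ∈ T) (he' : e' ∈ T) {u v : V}
    (huv : u ≠ v) (heu : G.a e = u ∨ G.b e = u) (hev : G.a e = v ∨ G.b e = v)
    (heu' : G.a e' = u ∨ G.b e' = u) (hev' : G.a e' = v ∨ G.b e' = v) : e = e' := by
  by_contra hne
  have h0 := eq_zero_of_acyclic O hacyc (f := Pi.single e 1 + Pi.single e' 1) ?_ ?_
  · have := congrFun h0 e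
    simp [hne] at this
  · intro i hi
    have h1 : i ≠ e := fun h => hi (h ▸ he)
    have h2 : i ≠ e' := fun h => hi (h ▸ he')
    simp [h1, h2]
  · rw [map_add, boundary_single_zmod_two, boundary_single_zmod_two]
    have hends : (G.a e = G.a e' ∧ G.b e = G.b e') ∨ (G.a e = G.b e' ∧ G.b e = G.a e') := by
      grind
    rcases hends with ⟨h1, h2⟩ | ⟨h1, h2⟩ <;> rw [h1, h2]
    · exact add_self_zmod_two _
    · rw [add_comm (Pi.single (G.a e') 1 : V → ZMod 2), add_self_zmod_two]

theorem Grown.existsUnique_edge (hacyc : ∀ C : Finset E, C ⊆ T → ¬ G.IsCircuit C)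
    (O : G.Orientation) {r : V} {S : Finset E} {X : Finset V}
    (h : G.Grown T r S X) : ∀ v ∈ G.touched S, v ∉ X → ∃ p, G.star S v = {p} := by
  induction h with
  | base e he =>
    intro v hv _
    obtain ⟨e', he', hev⟩ := mem_touched.1 hv
    rw [mem_singleton] at he'
    subst he'
    exact ⟨e', by rw [star, filter_singleton, if_pos hev]⟩
  | step S X v h hv hX hdeg ih =>
    intro u hu hux
    rw [mem_insert, not_or] at hux
    by_cases huS : u ∈ G.touched S
    · obtain ⟨p, hp⟩ := ih u huS hux.2
      refine ⟨p, hp ▸ ?_⟩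
      ext e
      rw [mem_star, mem_star, and_congr_left_iff]
      intro heu
      refine ⟨fun he => (mem_union.1 he).elim id fun he => ?_, mem_union_left _⟩
      obtain ⟨heT, hev⟩ := mem_star.1 he
      have hsub : G.a e ∈ G.touched S ∧ G.b e ∈ G.touched S := by grind
      exact h.mem_of_ends_touched hacyc O heT hsub.1 hsub.2
    · have hmem : ∀ e ∈ S ∪ G.star T v, (G.a e = u ∨ G.b e = u) → e ∈ G.star T v :=
        fun e he heu => (mem_union.1 he).resolve_left fun heS => huS (mem_touched.2 ⟨e, heS, heu⟩)
      obtain ⟨p, hp, hpu⟩ := mem_touched.1 hu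
      have hpv := mem_star.1 (hmem p hp hpu)
      refine ⟨p, eq_singleton_iff_unique_mem.2 ⟨mem_star.2 ⟨hp, hpu⟩, fun e he => ?_⟩⟩
      obtain ⟨he, heu⟩ := mem_star.1 he
      have hev := mem_star.1 (hmem e he heu)
      exact eq_of_same_ends hacyc O hev.1 hpv.1 hux.1 heu hev.2 hpu hpv.2

open Classical in
/-- The number of nowhere-zero functions on a grown subtree satisfying Kirchhoff's law at its
interior vertices. -/
theorem Grown.card_eq (hacyc : ∀ C : Finset E, C ⊆ T → ¬ G.IsCircuit C)
    (O : G.Orientation) {Γ : Type} [AddCommGroup Γ] [Fintype Γ] {r : V}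
    {S : Finset E} {X : Finset V} (h : G.Grown T r S X) :
    (((fullSupport Γ S).filter (fun f => ∀ v ∈ X, boundary O f v = 0)).card : ℤ) =
      ((Fintype.card Γ : ℤ) - 1) *
        ∏ v ∈ X, nonzeroSumCount (Fintype.card Γ) (G.deg T v - 1) := by
  have hne := ends_ne_of_acyclic hacyc O
  induction h with
  | base e he => simp [card_fullSupport]
  | step S X v h hv hX hdeg ih =>
    obtain ⟨p, hp⟩ := h.existsUnique_edge hacyc O v hv hX
    have hpS : p ∈ S ∧ (G.a p = v ∨ G.b p = v) := mem_star.1 (hp ▸ mem_singleton_self p)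
    have hpT := h.subset hpS.1
    have honly : ∀ e ∈ S, e ≠ p → ¬ (G.a e = v ∨ G.b e = v) := fun e he hep hev =>
      hep (mem_singleton.1 (hp ▸ mem_star.2 ⟨he, hev⟩))
    have hunion : S ∪ G.star T v = S ∪ (G.star T v \ S) := by simp
    have hcard : (G.star T v \ S).card = G.deg T v - 1 := by
      have : G.star T v \ S = (G.star T v).erase p := by
        ext e
        rw [mem_sdiff, mem_erase, and_comm]
        refine and_congr_left fun he => ?_
        refine ⟨fun h h' => h (h' ▸ hpS.1), fun h' heS => honly e heS h' (mem_star.1 he).2⟩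
      rw [this, card_erase_of_mem (mem_star.2 ⟨hpT, hpS.2⟩), deg_eq_card_star hne]
    have hstep := card_fullSupport_union (Γ := Γ) (S := S) (K := G.star T v \ S) disjoint_sdiff
      hpS.1 (O.coeff v)
      (fun e he => by
        obtain ⟨heT, hev⟩ := mem_star.1 (mem_sdiff.1 he).1
        exact O.coeff_unit hev (hne e heT))
      (O.coeff_unit hpS.2 (hne p hpT))
      (fun e he hep => O.coeff_eq_zero (honly e he hep))
      (fun f => ∀ u ∈ X, boundary O f u = 0) (fun f => ∀ u ∈ insert v X, boundary O f u = 0)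
      (fun f hf => forall₂_congr fun u hu => by
        rw [boundary_eq_sum O (S := S) (f := S.piecewise f 0) (fun e he => by simp [he]),
          boundary_eq_sum O (apply_eq_zero_of_mem_fullSupport hf)]
        rw [← sum_subset (subset_union_left (s₁ := S))]
        · rw [sum_congr rfl fun e he => by rw [← piecewise_eq_of_mem S f 0 he]]
        · intro e he heS
          rw [O.coeff_eq_zero, zero_smul]
          intro heu
          have heT := (mem_star.1 (mem_sdiff.1 ((mem_union.1 he).resolve_left heS)).1).1
          exact heS ((h.star_subset u hu).2 (mem_star.2 ⟨heT, heu⟩)))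
      (fun f hf => by
        rw [forall_mem_insert, boundary_eq_sum O (apply_eq_zero_of_mem_fullSupport hf), and_comm])
    rw [prod_insert hX, mul_left_comm, ← ih, mul_comm, ← hcard, hunion, hstep]

/-- A connected edge set can be grown completely from any of its leaves. -/
theorem Grown.exists_eq (hacyc : ∀ C : Finset E, C ⊆ T → ¬ G.IsCircuit C) (O : G.Orientation)
    (hconn : ∀ v ∈ G.touched T, ∀ w ∈ G.touched T, Relation.ReflTransGen (G.AdjIn T) v w)
    {r : V} (hr : G.deg T r = 1) :
    G.Grown T r T ((G.touched T).filter (fun v => 2 ≤ G.deg T v)) := by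
  classical
  have hne := ends_ne_of_acyclic hacyc O
  obtain ⟨e₀, he₀T, he₀⟩ := deg_pos_iff.1 (by omega : 0 < G.deg T r)
  have hbase : G.Grown T r {e₀} ∅ := Grown.base e₀ (mem_star.2 ⟨he₀T, he₀⟩)
  obtain ⟨⟨S, X⟩, hSX, hmax⟩ := exists_max_image
    (univ.filter (fun q : Finset E × Finset V => G.Grown T r q.1 q.2)) (fun q => q.2.card)
    ⟨({e₀}, ∅), by simpa using hbase⟩
  simp only [mem_filter, mem_univ, true_and, Prod.forall] at hSX hmax
  have hX : ∀ v ∈ G.touched S, 2 ≤ G.deg T v → v ∈ X := by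
    intro v hv hdeg
    by_contra hvX
    have := hmax _ _ (hSX.step S X v hv hvX hdeg)
    rw [card_insert_of_notMem hvX] at this
    omega
  have hstar : ∀ v ∈ G.touched S, G.star T v ⊆ S := by
    intro v hv
    by_cases hdeg : 2 ≤ G.deg T v
    · exact (hSX.star_subset v (hX v hv hdeg)).2
    · obtain ⟨e, he, hev⟩ := mem_touched.1 hv
      have hcard : (G.star T v).card ≤ 1 := by
        rw [← deg_eq_card_star hne]
        omega
      intro e' he'
      rwa [card_le_one.1 hcard e' he' e (mem_star.2 ⟨hSX.subset he, hev⟩)]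
  have hST : S = T := by
    refine hSX.subset.antisymm fun e he => ?_
    obtain ⟨e₁, he₁⟩ : S.Nonempty := by
      cases hSX with
      | base e he => exact singleton_nonempty e
      | step S X v h hv =>
        obtain ⟨e, he, -⟩ := mem_touched.1 hv
        exact ⟨e, mem_union_left _ he⟩
    have hreach : G.a e ∈ G.touched S := by
      have hpath := hconn _ (a_mem_touched (hSX.subset he₁)) _ (a_mem_touched he)
      generalize G.a e = w at hpath ⊢
      induction hpath with
      | refl => exact a_mem_touched he₁
      | tail _ huw ih =>
        obtain ⟨e₂, he₂, h⟩ := huw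
        exact mem_touched.2 ⟨e₂, hstar _ ih (mem_star.2 ⟨he₂, by tauto⟩), by tauto⟩
    exact hstar _ hreach (mem_star.2 ⟨he, Or.inl rfl⟩)
  subst hST
  convert hSX using 1
  ext v
  rw [mem_filter]
  refine ⟨fun h => hX v h.1 h.2, fun h => ?_⟩
  have hdeg := (hSX.star_subset v h).1
  exact ⟨mem_touched.2 (deg_pos_iff.1 (by omega)), hdeg⟩

end Growing


section Attaching

variable {V E : Type} [Fintype V] [DecidableEq V] [Fintype E] [DecidableEq E]
  {G : SignedGraph V E}

open Classical in
/-- If unbalanced circuits are attached to the leaves of `T`, then a nowhere-zero flow is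
determined by its restriction to `T`, on which Kirchhoff's law at the interior vertices is the
only condition. -/
theorem card_flows_eq_card_fullSupport (O : G.Orientation) {T : Finset E}
    (hne : ∀ e ∈ T, G.a e ≠ G.b e) {C : V → Finset E}
    (hcirc : ∀ l, G.deg T l = 1 → G.IsUnbalancedCircuit (C l))
    (hattach : ∀ l, G.deg T l = 1 → l ∈ G.touched (C l))
    (hmeet : ∀ l, G.deg T l = 1 → ∀ v ∈ G.touched (C l), v ∈ G.touched T → v = l)
    (hdisj : ∀ l l', G.deg T l = 1 → G.deg T l' = 1 → l ≠ l' →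
      ∀ v ∈ G.touched (C l), v ∉ G.touched (C l'))
    (hE : ∀ e, e ∈ T ∨ ∃ l, G.deg T l = 1 ∧ e ∈ C l)
    {Γ : Type} [AddCommGroup Γ] [Fintype Γ] (hodd : Odd (Fintype.card Γ)) :
    Nat.card {f : E → Γ // G.IsFlow O f ∧ ∀ e, f e ≠ 0} =
      ((fullSupport Γ T).filter (fun f =>
        ∀ v ∈ (G.touched T).filter (fun v => 2 ≤ G.deg T v), boundary O f v = 0)).card := by
  have hCT : ∀ l, G.deg T l = 1 → ∀ e ∈ C l, e ∉ T := by
    intro l hl e heC heT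
    refine hne e heT ?_
    rw [hmeet l hl _ (a_mem_touched heC) (a_mem_touched heT),
      hmeet l hl _ (b_mem_touched heC) (b_mem_touched heT)]
  have hCC : ∀ l l', G.deg T l = 1 → G.deg T l' = 1 → l ≠ l' → ∀ e ∈ C l, e ∉ C l' :=
    fun l l' hl hl' hll e he he' => hdisj l l' hl hl' hll _ (a_mem_touched he) (a_mem_touched he')
  have hleaf : ∀ g ∈ fullSupport Γ T, ∀ l, G.deg T l = 1 → boundary O g l ≠ 0 := by
    intro g hg l hl
    rw [deg_eq_card_star hne] at hl
    obtain ⟨e, he⟩ := card_eq_one.1 hl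
    obtain ⟨heT, hel⟩ := mem_star.1 (he ▸ mem_singleton_self e)
    rw [boundary_eq_sum O (apply_eq_zero_of_mem_fullSupport hg), sum_eq_single_of_mem e heT]
    · intro h0
      refine (mem_fullSupport.1 hg e).2 heT ?_
      rw [← unit_smul_unit_smul (O.coeff_unit hel (hne e heT)) (g e), h0, smul_zero]
    · intro e' he' hee'
      rw [O.coeff_eq_zero fun h => hee' (mem_singleton.1 (he ▸ mem_star.2 ⟨he', h⟩)), zero_smul]
  rw [Nat.card_eq_fintype_card, Fintype.card_subtype]
  refine card_nbij (fun f => T.piecewise f 0) ?_ ?_ ?_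
  · intro f hf
    simp only [coe_filter, mem_univ, true_and, Set.mem_ofPred_eq] at hf ⊢
    refine ⟨mem_fullSupport.2 fun e => ?_, fun v hv => ?_⟩
    · by_cases he : e ∈ T <;> simp [he, hf.2 e]
    · obtain ⟨hvT, hdeg⟩ := mem_filter.1 hv
      refine Eq.trans ?_ (congrFun ((isFlow_iff O f).1 hf.1) v)
      rw [boundary_apply, boundary_apply]
      refine sum_congr rfl fun e _ => ?_
      by_cases he : e ∈ T
      · simp [he]
      · obtain ⟨l, hl, hel⟩ := (hE e).resolve_left he
        rw [O.coeff_eq_zero, zero_smul, zero_smul]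
        intro hev
        have := hmeet l hl v (mem_touched.2 ⟨e, hel, hev⟩) hvT
        subst this
        omega
  · intro f hf f' hf' hff
    simp only [coe_filter, mem_univ, true_and, Set.mem_ofPred_eq] at hf hf'
    have hT : ∀ e ∈ T, f e - f' e = 0 := fun e he => by
      simpa [he, sub_eq_zero] using congrFun hff e
    have hb : boundary O (f - f') = 0 := by
      rw [map_sub, (isFlow_iff O f).1 hf.1, (isFlow_iff O f').1 hf'.1, sub_zero]
    rw [← sub_eq_zero]
    funext e
    by_cases he : e ∈ T
    · exact hT e he
    obtain ⟨l, hl, hel⟩ := (hE e).resolve_left he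
    have h0 : (C l).piecewise (f - f') 0 = 0 := by
      refine (hcirc l hl).boundary_injective O hodd (fun e he => by simp [he]) (funext fun v => ?_)
      by_cases hv : v ∈ G.touched (C l)
      · rw [← hb, boundary_apply, boundary_apply]
        refine sum_congr rfl fun i _ => ?_
        by_cases hi : i ∈ C l
        · rw [piecewise_eq_of_mem _ _ _ hi]
        rw [piecewise_eq_of_notMem _ _ _ hi]
        rcases hE i with hiT | ⟨l', hl', hil'⟩
        · simp [hT i hiT]
        · rw [O.coeff_eq_zero, zero_smul, zero_smul]
          intro hiv
          refine hdisj l l' hl hl' ?_ v hv (mem_touched.2 ⟨i, hil', hiv⟩)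
          rintro rfl
          exact hi hil'
      · exact boundary_eq_zero_of_not_touched O (S := C l) (fun e he => by simp [he])
          fun h => hv (mem_touched.2 h)
    simpa [hel] using congrFun h0 e
  · intro g hg
    obtain ⟨hgT, hgb⟩ := mem_filter.1 hg
    have hg0 := apply_eq_zero_of_mem_fullSupport hgT
    have hex : ∀ l, ∃ y : E → Γ, G.deg T l = 1 →
        (∀ e ∉ C l, y e = 0) ∧ boundary O y = Pi.single l (-boundary O g l) := by
      intro l
      by_cases hl : G.deg T l = 1
      · obtain ⟨y, hy⟩ := (hcirc l hl).exists_boundary_eq O hodd (hattach l hl) (-boundary O g l)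
        exact ⟨y, fun _ => hy⟩
      · exact ⟨0, fun h => absurd h hl⟩
    choose y hy using hex
    let L := univ.filter (fun l => G.deg T l = 1)
    have hL : ∀ {l}, l ∈ L ↔ G.deg T l = 1 := by simp [L]
    let f : E → Γ := g + ∑ l ∈ L, y l
    have hfT : ∀ e ∈ T, f e = g e := by
      intro e he
      simp only [f, Pi.add_apply, Finset.sum_apply, add_eq_left]
      exact sum_eq_zero fun l hl => (hy l (hL.1 hl)).1 e fun h => hCT l (hL.1 hl) e h he
    have hfC : ∀ l, G.deg T l = 1 → ∀ e ∈ C l, f e = y l e := by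
      intro l hl e he
      simp only [f, Pi.add_apply, Finset.sum_apply, hg0 e (hCT l hl e he), zero_add]
      exact sum_eq_single_of_mem l (hL.2 hl) fun l' hl' hne =>
        (hy l' (hL.1 hl')).1 e (hCC l l' hl (hL.1 hl') hne.symm e he)
    refine ⟨f, ?_, funext fun e => ?_⟩
    · simp only [coe_filter, mem_univ, true_and, Set.mem_ofPred_eq]
      refine ⟨(isFlow_iff O f).2 ?_, fun e => ?_⟩
      · rw [map_add, map_sum, sum_congr rfl fun l hl => (hy l (hL.1 hl)).2]
        funext v
        rw [Pi.add_apply, Finset.sum_apply, Pi.zero_apply]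
        simp only [Pi.single_apply, sum_ite_eq, hL]
        by_cases hv : G.deg T v = 1
        · simp [hv]
        rw [if_neg hv, add_zero]
        by_cases hvT : v ∈ G.touched T
        · have := deg_pos_iff.2 (mem_touched.1 hvT)
          exact hgb v (mem_filter.2 ⟨hvT, by omega⟩)
        · exact boundary_eq_zero_of_not_touched O hg0 fun h => hvT (mem_touched.2 h)
      · rcases hE e with he | ⟨l, hl, he⟩
        · rw [hfT e he]
          exact (mem_fullSupport.1 hgT e).2 he
        · rw [hfC l hl e he]
          exact (hcirc l hl).1.ne_zero_of_boundary_eq_single O (neg_ne_zero.2 (hleaf g hgT l hl))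
            (hy l hl).1 (hy l hl).2 e he
    · by_cases he : e ∈ T
      · simp [he, hfT e he]
      · simp [he, hg0 e he]

end Attaching

end SignedGraph

/-- Let `G_T` be the signed graph obtained from a tree `T` (with at
least two vertices, all edges positive) by attaching a pairwise vertex-disjoint unbalanced
circuit at each leaf, each circuit meeting the tree only in its leaf. If `v₁, …, v_p` are
the tree vertices of degree `d_i ≥ 3`, then for every finite abelian group `Γ` of odd
order `k`, the number of nowhere-zero `Γ`-flows in `G_T` is
`(k-1) · ∏ᵢ ∑_{j=0}^{dᵢ-2} (-1)^j C(dᵢ-1, j) k^{dᵢ-2-j}`. -/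
theorem flow_count_tree_of_circuits {V E : Type}
    [Fintype V] [DecidableEq V] [Fintype E] [DecidableEq E]
    (G : SignedGraph V E) (O : G.Orientation)
    (T : Finset E)
    (VT : Finset V)
    (hVT : VT = Finset.univ.filter (fun v => ∃ e ∈ T, G.a e = v ∨ G.b e = v))
    -- `T` is a tree on the vertex set `VT`, with at least two vertices, all edges positive
    (hpos : ∀ e ∈ T, G.sign e = 1)
    (htwo : 2 ≤ VT.card)
    (htreeconn : ∀ v ∈ VT, ∀ w ∈ VT, Relation.ReflTransGen (G.AdjIn T) v w)
    (hacyc : ∀ C : Finset E, C ⊆ T → ¬ G.IsCircuit C)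
    -- an unbalanced circuit `C l` is attached at each leaf `l` of `T`
    (C : V → Finset E)
    (hcirc : ∀ l ∈ VT, G.deg T l = 1 → G.IsUnbalancedCircuit (C l))
    (hattach : ∀ l ∈ VT, G.deg T l = 1 → ∃ e ∈ C l, G.a e = l ∨ G.b e = l)
    -- each circuit meets the tree only in its leaf
    (hmeet : ∀ l ∈ VT, G.deg T l = 1 →
      ∀ v : V, (∃ e ∈ C l, G.a e = v ∨ G.b e = v) → v ∈ VT → v = l)
    -- the circuits are pairwise vertex-disjoint
    (hdisj : ∀ l ∈ VT, ∀ l' ∈ VT, G.deg T l = 1 → G.deg T l' = 1 → l ≠ l' →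
      ∀ v : V, (∃ e ∈ C l, G.a e = v ∨ G.b e = v) →
        ¬ (∃ e ∈ C l', G.a e = v ∨ G.b e = v))
    -- `G` consists exactly of the tree together with the attached circuits
    (hE : ∀ e : E, e ∈ T ∨ ∃ l ∈ VT, G.deg T l = 1 ∧ e ∈ C l)
    (hV : ∀ v : V, v ∈ VT ∨ ∃ l ∈ VT, G.deg T l = 1 ∧ ∃ e ∈ C l, G.a e = v ∨ G.b e = v)
    (Γ : Type) [AddCommGroup Γ] [Fintype Γ] (k : ℕ) (hk : Fintype.card Γ = k)
    (hodd : Odd k) :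
    (Nat.card {f : E → Γ // G.IsFlow O f ∧ ∀ e, f e ≠ 0} : ℤ) =
      ((k : ℤ) - 1) * ∏ v ∈ VT.filter (fun v => 3 ≤ G.deg T v),
        ∑ j ∈ Finset.range (G.deg T v - 1),
          (-1 : ℤ) ^ j * ((G.deg T v - 1).choose j : ℤ) *
            (k : ℤ) ^ (G.deg T v - 2 - j) := by
  classical
  subst hk
  obtain rfl : VT = G.touched T := by
    ext v
    simp [hVT, SignedGraph.mem_touched]
  have hleaf : ∀ l, G.deg T l = 1 → l ∈ G.touched T := fun l hl =>
    SignedGraph.mem_touched.2 (SignedGraph.deg_pos_iff.1 (by omega))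
  have hTne : T.Nonempty := by
    obtain ⟨v, hv⟩ := Finset.card_pos.1 (by omega : 0 < (G.touched T).card)
    obtain ⟨e, he, -⟩ := SignedGraph.mem_touched.1 hv
    exact ⟨e, he⟩
  obtain ⟨r, hr⟩ := SignedGraph.exists_deg_eq_one hTne hacyc O
  have hgrown := SignedGraph.Grown.exists_eq hacyc O htreeconn hr
  rw [SignedGraph.card_flows_eq_card_fullSupport O (SignedGraph.ends_ne_of_acyclic hacyc O)
    (C := C) (fun l hl => hcirc l (hleaf l hl) hl)
    (fun l hl => SignedGraph.mem_touched.2 (hattach l (hleaf l hl) hl))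
    (fun l hl v hv hvT => hmeet l (hleaf l hl) hl v (SignedGraph.mem_touched.1 hv) hvT)
    (fun l l' hl hl' hne v hv hv' => hdisj l (hleaf l hl) l' (hleaf l' hl') hl hl' hne v
      (SignedGraph.mem_touched.1 hv) (SignedGraph.mem_touched.1 hv'))
    (fun e => (hE e).imp_right fun ⟨l, _, hl, he⟩ => ⟨l, hl, he⟩) hodd,
    hgrown.card_eq hacyc O]
  congr 1
  symm
  refine Finset.prod_subset_one_on_sdiff (fun v hv => ?_) (fun v hv => ?_) (fun v _ => ?_)
  · rw [Finset.mem_filter] at hv ⊢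
    exact ⟨hv.1, by omega⟩
  · simp only [Finset.mem_sdiff, Finset.mem_filter, not_and, not_le] at hv
    rw [show G.deg T v = 2 by have := hv.2 hv.1.1; omega]
    simp [SignedGraph.nonzeroSumCount]
  · simp only [SignedGraph.nonzeroSumCount, Nat.sub_sub, Nat.reduceAdd]
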